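/- arXiv:1109.3390 — 3 statements merged into one kernel-verified Lean document; each statement's English description precedes it below -/
import Mathlib

section
/- Every saturated 2-forest is tight. That is, if H = (V,E) is a 2-graph that is a 2-forest and such that for every 2-element subset e' of V with e' ∉ E the graph (V, E ∪ {e'}) is not a 2-forest, then hc(H) = 2. -/
/-- A `k`-graph `(V, E)` is a *`k`-forest* if for every edge `e ∈ E` there is a
surjective `k`-coloring of the vertices under which `e` is the only rainbow edge
(an edge `f` is rainbow under `c` if `|c(f)| = k`). -/
def IsKForest {V : Type*} [DecidableEq V] (k : ℕ) (E : Finset (Finset V)) : Prop :=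
  ∀ e ∈ E, ∃ c : V → Fin k, Function.Surjective c ∧
    ∀ f ∈ E, ((f.image c).card = k ↔ f = e)

/-- The heterochromatic number of a `k`-graph `(V, E)`: the minimum number `t ≥ 1`
of colors such that every surjective `t`-coloring of the vertices has a rainbow
edge. -/
noncomputable def hetNumber {V : Type*} (k : ℕ) (E : Finset (Finset V)) : ℕ :=
  sInf {t : ℕ | 0 < t ∧ ∀ c : V → Fin t, Function.Surjective c →
    ∃ e ∈ E, (e.image c).card = k}

theorem card_image_pair_iff {V : Type*} [DecidableEq V] (c : V → Fin 2) (a b : V) :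
    ((({a, b} : Finset V).image c).card = 2 ↔ c a ≠ c b) := by
  rw [Finset.image_insert, Finset.image_singleton]
  constructor
  · intro h hab
    simp [hab] at h
  · exact fun h => Finset.card_pair h

theorem surjective_of_ne {V : Type*} (c : V → Fin 2) (a b : V) (h : c a ≠ c b) :
    Function.Surjective c := by
  intro y
  by_cases hy : c a = y
  · exact ⟨a, hy⟩
  · exact ⟨b, by omega⟩

/-- Every saturated 2-forest is tight: if `(V, E)` is a 2-forest such that adding any
new 2-element edge yields a graph that is not a 2-forest, then its heterochromatic
number is 2. -/
theorem saturated_twoForest_tight {V : Type*} [Fintype V] [DecidableEq V] [Nonempty V]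
    (E : Finset (Finset V)) (h2 : ∀ e ∈ E, e.card = 2)
    (hforest : IsKForest 2 E)
    (hsat : ∀ e' : Finset V, e'.card = 2 → e' ∉ E → ¬ IsKForest 2 (insert e' E)) :
    hetNumber 2 E = 2 := by
  have key : ∀ c : V → Fin 2, Function.Surjective c → ∃ e ∈ E, (e.image c).card = 2 := by
    intro c hc
    by_contra hno
    push Not at hno
    obtain ⟨u, hu⟩ := hc 0
    obtain ⟨v, hv⟩ := hc 1
    have hcuv : c u ≠ c v := by rw [hu, hv]; decide
    have huv : u ≠ v := fun h => hcuv (by rw [h])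
    have hr : ((({u, v} : Finset V).image c).card = 2) := (card_image_pair_iff c u v).2 hcuv
    have hnot : ({u, v} : Finset V) ∉ E := fun h => hno _ h hr
    refine hsat {u, v} (Finset.card_pair huv) hnot ?_
    intro e he
    rcases Finset.mem_insert.1 he with rfl | heE
    · refine ⟨c, hc, fun f hf => ?_⟩
      rcases Finset.mem_insert.1 hf with rfl | hfE
      · exact ⟨fun _ => rfl, fun _ => hr⟩
      · exact ⟨fun h => absurd h (hno f hfE), fun h => absurd (h ▸ hfE) hnot⟩
    · obtain ⟨d, hd, hde⟩ := hforest e heE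
      have hne : ({u, v} : Finset V) ≠ e := fun h => hnot (h ▸ heE)
      by_cases hduv : d u = d v
      · refine ⟨d, hd, fun f hf => ?_⟩
        rcases Finset.mem_insert.1 hf with rfl | hfE
        · rw [card_image_pair_iff]
          exact ⟨fun h => absurd hduv h, fun h => absurd h hne⟩
        · exact hde f hfE
      · have hE : ∀ f ∈ E, ((f.image (fun x => d x + c x)).card = 2 ↔ f = e) := by
          intro f hfE
          rw [← hde f hfE]
          obtain ⟨a, b, -, rfl⟩ := Finset.card_eq_two.1 (h2 f hfE)
          have h := hno _ hfE
          rw [ne_eq, card_image_pair_iff, not_not] at h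
          rw [card_image_pair_iff, card_image_pair_iff, h]
          simp
        refine ⟨fun x => d x + c x, ?_, fun f hf => ?_⟩
        · have h := (hE e heE).2 rfl
          obtain ⟨a, b, -, rfl⟩ := Finset.card_eq_two.1 (h2 e heE)
          exact surjective_of_ne _ a b ((card_image_pair_iff _ a b).1 h)
        · rcases Finset.mem_insert.1 hf with rfl | hfE
          · rw [card_image_pair_iff]
            refine ⟨fun h => absurd ?_ h, fun h => absurd h hne⟩
            simp only [hu, hv]
            generalize d u = p at *
            generalize d v = q at *
            revert p q
            omega
          · exact hE f hfE
  unfold hetNumber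
  refine le_antisymm (Nat.sInf_le ⟨by norm_num, ?_⟩) (le_csInf ⟨2, by norm_num, ?_⟩ ?_)
  · intro c hc
    obtain ⟨e, he, h⟩ := key c hc
    exact ⟨e, he, by convert h⟩
  · intro c hc
    obtain ⟨e, he, h⟩ := key c hc
    exact ⟨e, he, by convert h⟩
  · rintro t ⟨ht, h⟩
    by_contra hlt
    obtain rfl : t = 1 := by omega
    obtain ⟨x⟩ := ‹Nonempty V›
    obtain ⟨e, he, hcard⟩ := h (fun _ => 0) (fun y => ⟨x, Subsingleton.elim _ _⟩)
    have := Finset.card_le_univ (e.image (fun _ => (0 : Fin 1)))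
    rw [Fintype.card_fin] at this
    omega
end

section
/- Every saturated 3-forest on 4 vertices is tight. -/
theorem rainbow_erase_iff {V : Type*} [Fintype V] [DecidableEq V] (c : V → Fin 3) (x : V) :
    ((Finset.univ.erase x).image c).card = 3 ↔ ∀ j, ∃ y, y ≠ x ∧ c y = j := by
  have h : ((Finset.univ.erase x).image c).card = 3 ↔ (Finset.univ.erase x).image c = Finset.univ := by
    rw [← Finset.card_eq_iff_eq_univ, Fintype.card_fin]
  rw [h, Finset.eq_univ_iff_forall]
  simp

theorem exists_coloring_fin : ∀ v b : Fin 4, v ≠ b → ∃ c : Fin 4 → Fin 3,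
    (∀ j, ∃ y, c y = j) ∧ ∀ x, (∀ j, ∃ y, y ≠ x ∧ c y = j) ↔ (x = v ∨ x = b) := by
  decide +kernel

theorem exists_coloring {V : Type*} [Fintype V] [DecidableEq V] (hV : Fintype.card V = 4)
    (v b : V) (h : v ≠ b) : ∃ c : V → Fin 3, Function.Surjective c ∧
      ∀ x, ((Finset.univ.erase x).image c).card = 3 ↔ (x = v ∨ x = b) := by
  have e := Fintype.equivFinOfCardEq hV
  obtain ⟨c, hs, hc⟩ := exists_coloring_fin (e v) (e b) (by simpa using h)
  refine ⟨c ∘ e, Function.Surjective.comp hs e.surjective, fun x => ?_⟩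
  rw [rainbow_erase_iff]
  have := hc (e x)
  simp only [e.injective.eq_iff] at this
  rw [← this]
  refine forall_congr' fun j => ⟨?_, ?_⟩
  · rintro ⟨y, hy, rfl⟩
    exact ⟨e y, by simpa using hy, rfl⟩
  · rintro ⟨y, hy, rfl⟩
    exact ⟨e.symm y, by rintro rfl; simp at hy, by simp⟩

theorem eq_erase_of_card {V : Type*} [Fintype V] [DecidableEq V] (hV : Fintype.card V = 4)
    (e : Finset V) (he : e.card = 3) : ∃ x, e = Finset.univ.erase x := by
  have h : eᶜ.card = 1 := by rw [Finset.card_compl, hV, he]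
  obtain ⟨x, hx⟩ := Finset.card_eq_one.1 h
  refine ⟨x, ?_⟩
  rw [← compl_compl e, hx]
  ext y; simp


/-- Every saturated 3-forest on 4 vertices is tight. -/
theorem saturated_threeForest_four_vertices_tight {V : Type*} [Fintype V] [DecidableEq V]
    (hV : Fintype.card V = 4)
    (E : Finset (Finset V)) (h3 : ∀ e ∈ E, e.card = 3)
    (hforest : IsKForest 3 E)
    (hsat : ∀ e' : Finset V, e'.card = 3 → e' ∉ E → ¬ IsKForest 3 (insert e' E)) :
    hetNumber 3 E = 3 := by
  have key : ∀ a b : V, a ≠ b → Finset.univ.erase a ∈ E ∨ Finset.univ.erase b ∈ E := by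
    intro a b hab
    by_contra! hn
    obtain ⟨ha, hb⟩ := hn
    have hcard : (Finset.univ.erase a).card = 3 := by
      rw [Finset.card_erase_of_mem (Finset.mem_univ a), Finset.card_univ, hV]
    apply hsat _ hcard ha
    have h3' : ∀ e ∈ insert (Finset.univ.erase a) E, ∃ x, x ≠ b ∧ e = Finset.univ.erase x := by
      intro e he
      rcases Finset.mem_insert.1 he with rfl | he
      · exact ⟨a, hab, rfl⟩
      · obtain ⟨x, rfl⟩ := eq_erase_of_card hV e (h3 e he)
        exact ⟨x, by rintro rfl; exact hb he, rfl⟩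
    intro e he
    obtain ⟨v, hv, rfl⟩ := h3' e he
    obtain ⟨c, hs, hc⟩ := exists_coloring hV v b hv
    refine ⟨c, hs, fun f hf => ?_⟩
    obtain ⟨x, hx, rfl⟩ := h3' f hf
    rw [hc x]
    constructor
    · rintro (rfl | h)
      · rfl
      · exact absurd h hx
    · intro h
      left
      by_contra hne
      have : x ∈ Finset.univ.erase v := by simp [hne]
      rw [← h] at this
      simp at this
  have hmem : 0 < 3 ∧ ∀ c : V → Fin 3, Function.Surjective c →
      ∃ e ∈ E, (e.image c).card = 3 := by
    refine ⟨by norm_num, fun c hs => ?_⟩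
    obtain ⟨a, b, hab, hc⟩ := Fintype.exists_ne_map_eq_of_card_lt c (by simp [hV])
    have aux : ∀ a b : V, a ≠ b → c a = c b → ((Finset.univ.erase a).image c).card = 3 := by
      intro a b hab hc
      rw [rainbow_erase_iff]
      intro j
      obtain ⟨y, rfl⟩ := hs j
      by_cases hy : y = a
      · exact ⟨b, hab.symm, by rw [hy, hc]⟩
      · exact ⟨y, hy, rfl⟩
    rcases key a b hab with h | h
    · exact ⟨_, h, aux a b hab hc⟩
    · exact ⟨_, h, aux b a hab.symm hc.symm⟩
  unfold hetNumber
  apply le_antisymm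
  · exact Nat.sInf_le hmem
  · refine le_csInf ⟨3, hmem⟩ ?_
    rintro t ⟨ht, h⟩
    by_contra! hlt
    have e := Fintype.equivFinOfCardEq hV
    obtain ⟨f, -, hf⟩ := h (fun x => ⟨(e x).val % t, Nat.mod_lt _ ht⟩) (by
      intro j
      refine ⟨e.symm ⟨j.val, by omega⟩, ?_⟩
      ext
      simp [Nat.mod_eq_of_lt j.isLt])
    have := Finset.card_le_univ (f.image (fun x => (⟨(e x).val % t, Nat.mod_lt _ ht⟩ : Fin t)))
    rw [hf, Fintype.card_fin] at this
    omega
end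

section
/- Every saturated 3-forest on 5 vertices is tight. -/
namespace FiveForest

/-- The ten triples of `Fin 5`. -/
def T0 : Fin 10 → Finset (Fin 5) :=
  ![{0,1,2},{0,1,3},{0,1,4},{0,2,3},{0,2,4},{0,3,4},{1,2,3},{1,2,4},{1,3,4},{2,3,4}]

/-- Rainbow sets (as bit masks) of the 25 partitions of `Fin 5` into three parts. -/
def R : List ℕ := [7, 25, 30, 42, 45, 51, 52, 193, 198, 216, 322, 325, 360, 387, 388, 432,
  584, 593, 610, 649, 656, 676, 778, 788, 800]

/-- Rainbow mask of a coloring. -/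
def cmask (c : Fin 5 → Fin 3) : ℕ := Nat.ofBits (fun i : Fin 10 => decide (((T0 i).image c).card = 3))

/-- Forest test on masks. -/
def forestB (m : ℕ) : Bool :=
  (List.range 10).all fun i => !(m.testBit i) || R.any fun r => Nat.beq (Nat.land r m) (2 ^ i)

/-- The main finite check for one mask. -/
def checkB (m : ℕ) : Bool :=
  !(forestB m) || (R.all fun r => !(Nat.beq (Nat.land r m) 0)) ||
    (List.range 10).any fun i => !(m.testBit i) && forestB (Nat.lor m (2 ^ i))

theorem check_all : (List.range 1024).all checkB = true := by decide +kernel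

theorem T0_surj : ∀ s : Finset (Fin 5), s.card = 3 → ∃ i, T0 i = s := by decide +kernel
theorem T0_inj : ∀ i j, T0 i = T0 j → i = j := by decide +kernel
theorem T0_card : ∀ i, (T0 i).card = 3 := by decide +kernel

theorem cmask_mem : ∀ c : Fin 5 → Fin 3, Function.Surjective c → cmask c ∈ R := by
  decide +kernel

theorem mem_cmask : ∀ r ∈ R, ∃ c : Fin 5 → Fin 3, Function.Surjective c ∧ cmask c = r := by
  decide +kernel

section
variable {V : Type*} [DecidableEq V] (e : Fin 5 ≃ V)

/-- The ten triples of `V`. -/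
def T (i : Fin 10) : Finset V := (T0 i).map e.toEmbedding

/-- Mask of an edge set. -/
def mk (E : Finset (Finset V)) : ℕ := Nat.ofBits (fun i : Fin 10 => decide (T e i ∈ E))

theorem T_inj {i j : Fin 10} (h : T e i = T e j) : i = j :=
  T0_inj _ _ (Finset.map_injective _ h)

theorem T_card (i : Fin 10) : (T e i).card = 3 := by simp [T, T0_card]

theorem T_surj (s : Finset V) (hs : s.card = 3) : ∃ i, T e i = s := by
  obtain ⟨i, hi⟩ := T0_surj (s.map e.symm.toEmbedding) (by simpa using hs)
  refine ⟨i, ?_⟩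
  rw [T, hi, Finset.map_map]
  ext x
  simp

theorem image_T {α : Type*} [DecidableEq α] (c : V → α) (i : Fin 10) :
    (T e i).image c = (T0 i).image (c ∘ e) := by
  rw [T, Finset.map_eq_image, Finset.image_image]
  rfl

theorem land_eq_iff (E : Finset (Finset V)) (c : Fin 5 → Fin 3) (i : Fin 10) (hi : T e i ∈ E) :
    Nat.land (cmask c) (mk e E) = 2 ^ (i : ℕ) ↔
      ∀ j, T e j ∈ E → (((T0 j).image c).card = 3 ↔ j = i) := by
  change (cmask c) &&& (mk e E) = 2 ^ (i : ℕ) ↔ _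
  constructor
  · intro h j hj
    have := congrArg (fun n => n.testBit j) h
    simp only [Nat.testBit_and, cmask, mk, Nat.testBit_ofBits_lt _ _ j.2, hj,
      Nat.testBit_two_pow] at this
    rw [Fin.ext_iff, eq_comm (a := (j : ℕ))]
    simpa using this
  · intro h
    apply Nat.eq_of_testBit_eq
    intro j
    rcases lt_or_ge j 10 with hj | hj
    · simp only [Nat.testBit_and, cmask, mk, Nat.testBit_ofBits_lt _ _ hj, Nat.testBit_two_pow]
      by_cases hE : T e ⟨j, hj⟩ ∈ E
      · have := h _ hE
        rw [Fin.ext_iff, eq_comm (b := (i : ℕ))] at this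
        simp [hE, this]
      · have : (i : ℕ) ≠ j := by rintro rfl; exact hE hi
        simp [hE, this]
    · have : (i : ℕ) ≠ j := by have := i.2; omega
      simp [Nat.testBit_and, cmask, mk, Nat.testBit_ofBits_ge _ _ hj, Nat.testBit_two_pow, this]

theorem forest_iff (E : Finset (Finset V)) (h3 : ∀ f ∈ E, f.card = 3) :
    forestB (mk e E) = true ↔ IsKForest 3 E := by
  have key : IsKForest 3 E ↔ ∀ i, T e i ∈ E → ∃ r ∈ R, Nat.land r (mk e E) = 2 ^ (i : ℕ) := by
    constructor
    · intro h i hi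
      obtain ⟨c, hc, hf⟩ := h _ hi
      refine ⟨cmask (c ∘ e), cmask_mem _ (hc.comp e.surjective), ?_⟩
      rw [land_eq_iff e E _ i hi]
      intro j hj
      rw [← image_T, hf _ hj]
      exact ⟨T_inj e, fun h => h ▸ rfl⟩
    · intro h f hf
      obtain ⟨i, rfl⟩ := T_surj e f (h3 f hf)
      obtain ⟨r, hr, hm⟩ := h i hf
      obtain ⟨c, hc, rfl⟩ := mem_cmask r hr
      rw [land_eq_iff e E _ i hf] at hm
      refine ⟨c ∘ e.symm, hc.comp e.symm.surjective, ?_⟩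
      intro g hg
      obtain ⟨j, rfl⟩ := T_surj e g (h3 g hg)
      rw [image_T, Function.comp_assoc, Equiv.symm_comp_self, Function.comp_id, hm j hg]
      exact ⟨fun h => h ▸ rfl, T_inj e⟩
  rw [key]
  simp only [forestB, List.all_eq_true, List.mem_range, Bool.or_eq_true, List.any_eq_true,
    Nat.beq_eq, Bool.not_eq_true']
  constructor
  · intro h i hi
    rcases h i i.2 with h | h
    · simp [mk, hi] at h
    · exact h
  · intro h i hi
    by_cases hE : T e ⟨i, hi⟩ ∈ E
    · exact Or.inr (h _ hE)
    · left
      simp [mk, hi, hE]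

theorem mk_insert (E : Finset (Finset V)) (i : Fin 10) :
    mk e (insert (T e i) E) = Nat.lor (mk e E) (2 ^ (i : ℕ)) := by
  change _ = mk e E ||| 2 ^ (i : ℕ)
  apply Nat.eq_of_testBit_eq
  intro j
  rcases lt_or_ge j 10 with hj | hj
  · simp only [Nat.testBit_or, mk, Nat.testBit_ofBits_lt _ _ hj, Nat.testBit_two_pow,
      Finset.mem_insert]
    have : T e ⟨j, hj⟩ = T e i ↔ (i : ℕ) = j :=
      ⟨fun h => (congrArg Fin.val (T_inj e h)).symm, fun h => by subst h; rfl⟩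
    simp only [this, Bool.decide_or, Bool.or_comm]
  · have : (i : ℕ) ≠ j := by have := i.2; omega
    simp [Nat.testBit_or, mk, Nat.testBit_ofBits_ge _ _ hj, Nat.testBit_two_pow, this]

end

end FiveForest

open FiveForest in
/-- Every saturated 3-forest on 5 vertices is tight. -/
theorem saturated_threeForest_five_vertices_tight {V : Type*} [Fintype V] [DecidableEq V]
    (hV : Fintype.card V = 5)
    (E : Finset (Finset V)) (h3 : ∀ e ∈ E, e.card = 3)
    (hforest : IsKForest 3 E)
    (hsat : ∀ e' : Finset V, e'.card = 3 → e' ∉ E → ¬ IsKForest 3 (insert e' E)) :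
    hetNumber 3 E = 3 := by
  let e : Fin 5 ≃ V := (Fintype.equivFinOfCardEq hV).symm
  have hlt : mk e E < 1024 := Nat.ofBits_lt_two_pow _
  have hchk := List.all_eq_true.1 check_all _ (List.mem_range.2 hlt)
  have hF := (forest_iff e E h3).2 hforest
  have hR : ∀ r ∈ R, Nat.land r (mk e E) ≠ 0 := by
    simp only [checkB, hF, Bool.not_true, Bool.false_or, Bool.or_eq_true] at hchk
    rcases hchk with h | h
    · intro r hr h0
      have := List.all_eq_true.1 h r hr
      rw [h0] at this
      simp at this
    · exfalso
      obtain ⟨i, hi, h⟩ := List.any_eq_true.1 h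
      rw [List.mem_range] at hi
      rw [Bool.and_eq_true] at h
      obtain ⟨h1, h2⟩ := h
      have hn : T e ⟨i, hi⟩ ∉ E := by simpa [mk, hi] using h1
      refine hsat _ (T_card e _) hn ?_
      rw [← forest_iff e, mk_insert]
      · exact h2
      · intro f hf
        rcases Finset.mem_insert.1 hf with rfl | hf
        · exact T_card e _
        · exact h3 f hf
  have hmem : ∀ c : V → Fin 3, Function.Surjective c → ∃ f ∈ E, (f.image c).card = 3 := by
    intro c hc
    by_contra! hcon
    refine hR _ (cmask_mem (c ∘ e) (hc.comp e.surjective)) ?_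
    change cmask (c ∘ e) &&& mk e E = 0
    apply Nat.eq_of_testBit_eq
    intro j
    rcases lt_or_ge j 10 with hj | hj
    · simp only [Nat.testBit_and, cmask, mk, Nat.testBit_ofBits_lt _ _ hj, Nat.zero_testBit]
      by_cases hE : T e ⟨j, hj⟩ ∈ E
      · have := hcon _ hE
        rw [image_T] at this
        simp [this]
      · simp [hE]
    · simp [Nat.testBit_and, cmask, mk, Nat.testBit_ofBits_ge _ _ hj]
  apply le_antisymm
  · exact Nat.sInf_le ⟨by norm_num, hmem⟩
  · refine le_csInf ⟨3, by norm_num, hmem⟩ ?_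
    rintro t ⟨ht, h⟩
    by_contra! hlt3
    haveI : NeZero t := ⟨ht.ne'⟩
    have hs : Function.Surjective
        (fun v : V => (Fin.ofNat t (e.symm v : ℕ))) := by
      intro x
      have := x.2
      refine ⟨e ⟨x, by omega⟩, ?_⟩
      ext
      simp [Fin.ofNat, Nat.mod_eq_of_lt x.2]
    obtain ⟨f, -, hf⟩ := h _ hs
    have := Finset.card_le_univ (f.image (fun v : V => (Fin.ofNat t (e.symm v : ℕ))))
    rw [hf, Fintype.card_fin] at this
    omega
end
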